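/- Two lollipops L(p,k) and L(p',k') with the same number of vertices p + k = p' + k' and p ≠ p' have different adjacency spectra; in fact if p < p', the graph L(p',k') has strictly fewer closed walks of length p than L(p,k). -/

import Mathlib

open Polynomial

/-- The characteristic polynomial (over `ℝ`) of the adjacency matrix of a finite graph. -/
noncomputable def graphCharpoly {V : Type*} [Fintype V] [DecidableEq V]
    (G : SimpleGraph V) : Polynomial ℝ :=
  letI := Classical.decRel G.Adj
  (G.adjMatrix ℝ).charpoly

/-- `Q_{P_n}`: the characteristic polynomial of the path on `n` vertices. -/
noncomputable def Qpath (n : ℕ) : Polynomial ℝ := graphCharpoly (SimpleGraph.pathGraph n)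

/-- `Q_{C_n}`: the characteristic polynomial of the cycle on `n` vertices. -/
noncomputable def Qcycle (n : ℕ) : Polynomial ℝ := graphCharpoly (SimpleGraph.cycleGraph n)

/-- The lollipop `L(p,k)`: a cycle on `p` vertices with a path of `k` further
vertices attached to one cycle vertex. -/
def lollipop (p k : ℕ) : SimpleGraph (Fin p ⊕ Fin k) :=
  SimpleGraph.fromRel (fun a b =>
    match a, b with
    | Sum.inl i, Sum.inl j => ((i : ℕ) + 1) % p = (j : ℕ)
    | Sum.inl i, Sum.inr j => (i : ℕ) = 0 ∧ (j : ℕ) = 0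
    | Sum.inr i, Sum.inr j => (i : ℕ) + 1 = (j : ℕ)
    | _, _ => False)

/-- The adjacency matrix (over `ℝ`) of a finite graph. -/
noncomputable def adjMat {V : Type*} [Fintype V] [DecidableEq V]
    (G : SimpleGraph V) : Matrix V V ℝ :=
  letI := Classical.decRel G.Adj
  G.adjMatrix ℝ

open Matrix in
theorem Matrix.IsHermitian.trace_pow_eq_sum_roots_charpoly {V : Type*} [Fintype V] [DecidableEq V]
    {A : Matrix V V ℝ} (hA : A.IsHermitian) (m : ℕ) :
    (A ^ m).trace = (A.charpoly.roots.map (· ^ m)).sum := by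
  conv_lhs => rw [hA.spectral_theorem, ← map_pow, Unitary.conjStarAlgAut_apply, trace_mul_comm,
    ← mul_assoc, Unitary.coe_star_mul_self, one_mul, diagonal_pow, trace_diagonal]
  rw [hA.roots_charpoly_eq_eigenvalues, Multiset.map_map]
  rfl

theorem add_pow_eq_pow_add_sum {R : Type*} [Semiring R] (a b : R) (m : ℕ) :
    (a + b) ^ m = a ^ m + ∑ i ∈ Finset.range m, a ^ i * b * (a + b) ^ (m - 1 - i) := by
  induction m with
  | zero => simp
  | succ m ih =>
    rw [Finset.sum_range_succ', pow_succ' (a + b), add_mul]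
    nth_rewrite 1 [ih]
    rw [mul_add, ← pow_succ', Finset.mul_sum, add_assoc]
    congr 2
    · refine Finset.sum_congr rfl fun i _ => ?_
      rw [pow_succ', Nat.add_sub_cancel, Nat.sub_sub, add_comm 1 i, mul_assoc, mul_assoc, mul_assoc]
    · simp

theorem hasDerivAt_clm_add_smul_pow {R : Type*} [NormedRing R] [NormedAlgebra ℝ R]
    (τ : R →L[ℝ] ℝ) (a b : R) (N : ℕ) (t : ℝ) :
    HasDerivAt (fun t : ℝ => τ ((a + t • b) ^ (N + 1)))
      (∑ i ∈ Finset.range (N + 1), τ ((a + t • b) ^ (N - i) * b * (a + t • b) ^ i)) t := by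
  have h : HasDerivAt (fun t : ℝ => a + t • b) b t := by
    simpa using ((hasDerivAt_id t).smul_const b).const_add a
  simpa using! τ.hasFDerivAt.comp_hasDerivAt t (h.fun_pow' (N + 1))

section EdgePerturbation

variable {V : Type*} [DecidableEq V]

/-- The adjacency matrix of the single edge joining `u` and `v`. -/
def edgeMatrix (u v : V) : Matrix V V ℝ := Matrix.single u v 1 + Matrix.single v u 1

theorem edgeMatrix_isSymm (u v : V) : (edgeMatrix u v).IsSymm := by
  simp [Matrix.IsSymm, edgeMatrix, Matrix.transpose_add, add_comm]

theorem edgeMatrix_nonneg (u v i j : V) : 0 ≤ edgeMatrix u v i j := by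
  simp only [edgeMatrix, Matrix.add_apply, Matrix.single_apply]
  split_ifs <;> norm_num

variable [Fintype V]

theorem mul_single_mul_apply (M N : Matrix V V ℝ) (u v a b : V) :
    (M * Matrix.single u v (1 : ℝ) * N) a b = M a u * N v b := by
  rw [Matrix.mul_apply, Finset.sum_eq_single v]
  · simp
  · intro l _ hl
    rw [Matrix.mul_single_apply_of_ne (hbj := hl), zero_mul]
  · simp

theorem mul_smul_edgeMatrix_mul_apply (M N : Matrix V V ℝ) (t : ℝ) (u v a b : V) :
    (M * (t • edgeMatrix u v) * N) a b = t * (M a u * N v b + M a v * N u b) := by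
  rw [Matrix.mul_smul, Matrix.smul_mul, Matrix.smul_apply, edgeMatrix, mul_add, add_mul,
    Matrix.add_apply, mul_single_mul_apply, mul_single_mul_apply, smul_eq_mul]

theorem add_smul_edgeMatrix_pow_apply (P : Matrix V V ℝ) (t : ℝ) (u v a b : V) (m : ℕ) :
    ((P + t • edgeMatrix u v) ^ m) a b = (P ^ m) a b + ∑ i ∈ Finset.range m,
      t * ((P ^ i) a u * ((P + t • edgeMatrix u v) ^ (m - 1 - i)) v b +
        (P ^ i) a v * ((P + t • edgeMatrix u v) ^ (m - 1 - i)) u b) := by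
  conv_lhs => rw [add_pow_eq_pow_add_sum, Matrix.add_apply, Matrix.sum_apply]
  simp only [mul_smul_edgeMatrix_mul_apply]

/-- If a weighted edge from `o` is attached at `c'` rather than at `c`, where closed walks are
rarer at `c'` than at `c` and `c'` is far away from `o`, then there are fewer walks of length `N`
along the edge. The difference is at least the number of walks from `o` to `c` avoiding it. -/
theorem edge_perturbation_pow_le {P : Matrix V V ℝ} (hP : P.IsSymm) (hP0 : ∀ i j, 0 ≤ P i j)
    {o c c' : V} {N : ℕ} (h0 : ∀ m ≤ N, (P ^ m) o c' = 0)
    (hc : ∀ m < N, (P ^ m) c' c' ≤ (P ^ m) c c) {t : ℝ} (ht : 0 ≤ t) :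
    ((P + t • edgeMatrix o c') ^ N) o c' + (P ^ N) o c ≤
      ((P + t • edgeMatrix o c) ^ N) o c := by
  set A := P + t • edgeMatrix o c with hA
  set A' := P + t • edgeMatrix o c' with hA'
  have nonneg_add (v i j : V) : 0 ≤ (P + t • edgeMatrix o v) i j := by
    simpa using add_nonneg (hP0 i j) (mul_nonneg ht (edgeMatrix_nonneg o v i j))
  have nP := Matrix.pow_apply_nonneg hP0
  have nA := Matrix.pow_apply_nonneg (nonneg_add c)
  have nA' := Matrix.pow_apply_nonneg (nonneg_add c')
  have h0' : ∀ m ≤ N, (P ^ m) c' o = 0 := fun m hm => by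
    rw [← (hP.pow m).apply, h0 m hm]
  have key : ∀ m ≤ N, (A' ^ m) o c' + (P ^ m) o c ≤ (A ^ m) o c ∧
      (m < N → (A' ^ m) c' c' ≤ (A ^ m) c c) := by
    intro m
    induction m using Nat.strong_induction_on with
    | _ m ih =>
      intro hm
      constructor
      · rw [hA, hA', add_smul_edgeMatrix_pow_apply, add_smul_edgeMatrix_pow_apply, ← hA, ← hA',
          h0 m hm, zero_add, add_comm]
        refine add_le_add le_rfl (Finset.sum_le_sum fun i hi => mul_le_mul_of_nonneg_left ?_ ht)
        have hi := Finset.mem_range.1 hi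
        rw [h0 i (by omega), zero_mul, add_zero]
        have := mul_le_mul_of_nonneg_left
          ((ih (m - 1 - i) (by omega) (by omega)).2 (by omega)) (nP i o o)
        have := mul_nonneg (nP i o c) (nA (m - 1 - i) o c)
        linarith
      · intro hmN
        rw [hA, hA', add_smul_edgeMatrix_pow_apply, add_smul_edgeMatrix_pow_apply, ← hA, ← hA']
        refine add_le_add (hc m hmN)
          (Finset.sum_le_sum fun i hi => mul_le_mul_of_nonneg_left ?_ ht)
        have hi := Finset.mem_range.1 hi
        rw [h0' i (by omega), zero_mul, zero_add]
        have h1 := (ih (m - 1 - i) (by omega) (by omega)).1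
        have h2 : (A' ^ (m - 1 - i)) o c' ≤ (A ^ (m - 1 - i)) o c := by
          linarith [nP (m - 1 - i) o c]
        have := mul_le_mul (hc i (by omega)) h2 (nA' _ o c') (nP i c c)
        have := mul_nonneg (nP i c o) (nA (m - 1 - i) c c)
        linarith
  exact (key N le_rfl).1

theorem hasDerivAt_trace_add_smul_edgeMatrix_pow {P : Matrix V V ℝ} (hP : P.IsSymm) (o c : V)
    (N : ℕ) (t : ℝ) :
    HasDerivAt (fun t : ℝ => ((P + t • edgeMatrix o c) ^ (N + 1)).trace)
      (2 * (N + 1) * ((P + t • edgeMatrix o c) ^ N) o c) t := by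
  set A := P + t • edgeMatrix o c
  have hA : A.IsSymm := hP.add ((edgeMatrix_isSymm o c).smul t)
  have hterm : ∀ i ∈ Finset.range (N + 1),
      (A ^ (N - i) * edgeMatrix o c * A ^ i).trace = 2 * (A ^ N) o c := by
    intro i hi
    have hi := Finset.mem_range.1 hi
    rw [Matrix.trace_mul_comm, ← mul_assoc, ← pow_add, Nat.add_sub_cancel' (by omega), edgeMatrix,
      mul_add, Matrix.trace_add, Matrix.trace_mul_single, Matrix.trace_mul_single]
    have := (hA.pow N).apply o c
    simp [this, two_mul]
  let τ := Matrix.traceLinearMap V ℝ ℝ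
  have h := @hasDerivAt_clm_add_smul_pow _ Matrix.linftyOpNormedRing Matrix.linftyOpNormedAlgebra
    ⟨τ, τ.continuous_of_finiteDimensional⟩ P (edgeMatrix o c) N t
  refine h.congr_deriv ((Finset.sum_congr rfl hterm).trans ?_)
  simp
  ring

theorem trace_edge_perturbation_pow_lt {P : Matrix V V ℝ} (hP : P.IsSymm)
    (hP0 : ∀ i j, 0 ≤ P i j) {o c c' : V} {N : ℕ} (h0 : ∀ m ≤ N, (P ^ m) o c' = 0)
    (hc : ∀ m < N, (P ^ m) c' c' ≤ (P ^ m) c c) (hN : 0 < (P ^ N) o c) :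
    ((P + edgeMatrix o c') ^ (N + 1)).trace < ((P + edgeMatrix o c) ^ (N + 1)).trace := by
  have hd (t : ℝ) := (hasDerivAt_trace_add_smul_edgeMatrix_pow hP o c N t).sub
    (hasDerivAt_trace_add_smul_edgeMatrix_pow hP o c' N t)
  have hmono := strictMonoOn_of_deriv_pos (convex_Icc (0 : ℝ) 1)
    (fun t _ => (hd t).continuousAt.continuousWithinAt) (fun t ht => by
      rw [(hd t).deriv, ← mul_sub]
      rw [interior_Icc] at ht
      have := edge_perturbation_pow_le hP hP0 h0 hc ht.1.le
      have : 0 < ((P + t • edgeMatrix o c) ^ N) o c - ((P + t • edgeMatrix o c') ^ N) o c' := by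
        linarith
      positivity)
  have := hmono (Set.left_mem_Icc.2 zero_le_one) (Set.right_mem_Icc.2 zero_le_one) zero_lt_one
  simpa using this

end EdgePerturbation

section Path

/-- The adjacency matrix of the path on `Fin n`. -/
def pathMatrix (n : ℕ) : Matrix (Fin n) (Fin n) ℝ :=
  Matrix.of fun i j => if (i : ℕ) + 1 = j ∨ (j : ℕ) + 1 = i then 1 else 0

variable {n : ℕ}

theorem pathMatrix_isSymm : (pathMatrix n).IsSymm := by
  ext i j
  simp [pathMatrix, or_comm]

theorem pathMatrix_nonneg (i j : Fin n) : 0 ≤ pathMatrix n i j := by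
  simp only [pathMatrix, Matrix.of_apply]
  split_ifs <;> norm_num

theorem pathMatrix_pow_apply_eq_zero {m : ℕ} {i j : Fin n} (h : (i : ℕ) + m < j) :
    (pathMatrix n ^ m) i j = 0 := by
  induction m generalizing j with
  | zero =>
    rw [pow_zero, Matrix.one_apply_ne]
    rintro rfl
    omega
  | succ m ih =>
    rw [pow_succ, Matrix.mul_apply]
    refine Finset.sum_eq_zero fun l _ => ?_
    by_cases hl : (i : ℕ) + m < l
    · rw [ih hl, zero_mul]
    · rw [pathMatrix, Matrix.of_apply, if_neg (by omega), mul_zero]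

theorem pathMatrix_pow_apply_pos {m : ℕ} {i j : Fin n} (h : (i : ℕ) + m = j) :
    0 < (pathMatrix n ^ m) i j := by
  induction m generalizing j with
  | zero =>
    obtain rfl : i = j := Fin.ext h
    simp
  | succ m ih =>
    rw [pow_succ, Matrix.mul_apply]
    refine Finset.sum_pos' (fun l _ => mul_nonneg
      (Matrix.pow_apply_nonneg pathMatrix_nonneg _ _ _) (pathMatrix_nonneg _ _))
      ⟨⟨i + m, by omega⟩, Finset.mem_univ _, mul_pos (ih rfl) ?_⟩
    simp [pathMatrix, ← h, add_assoc]

/-- Moving the start of a walk on the path towards the right end loses walks, as long as the walks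
are too short to see the left end. -/
theorem pathMatrix_pow_apply_shift_le {m s : ℕ} {c c' j j' : Fin n} (hm : m ≤ c)
    (hc : (c' : ℕ) = c + s) (hj : (j' : ℕ) = j + s) :
    (pathMatrix n ^ m) c' j' ≤ (pathMatrix n ^ m) c j := by
  induction m generalizing j j' with
  | zero =>
    have : c' = j' ↔ c = j := by rw [Fin.ext_iff, Fin.ext_iff]; omega
    simp [Matrix.one_apply, this]
  | succ m ih =>
    have nonneg := Matrix.pow_apply_nonneg (pathMatrix_nonneg (n := n))
    rw [pow_succ, Matrix.mul_apply, Matrix.mul_apply]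
    let f : Fin n → Fin n := fun l => ⟨l - s, by omega⟩
    calc ∑ l, (pathMatrix n ^ m) c' l * pathMatrix n l j'
        = ∑ l with s ≤ l.val, (pathMatrix n ^ m) c' l * pathMatrix n l j' := by
          refine (Finset.sum_filter_of_ne fun l _ hl => ?_).symm
          by_contra! hls
          refine hl ?_
          rw [← (pathMatrix_isSymm.pow m).apply, pathMatrix_pow_apply_eq_zero (by omega), zero_mul]
      _ ≤ ∑ l with s ≤ l.val, (pathMatrix n ^ m) c (f l) * pathMatrix n (f l) j := by
          refine Finset.sum_le_sum fun l hl => ?_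
          have hl : s ≤ (l : ℕ) := by simpa using hl
          have hfl : (l : ℕ) = (f l : ℕ) + s := (Nat.sub_add_cancel hl).symm
          have hadj : pathMatrix n l j' = pathMatrix n (f l) j := by
            simp only [pathMatrix, Matrix.of_apply]
            congr 1
            rw [eq_iff_iff]
            omega
          rw [hadj]
          exact mul_le_mul_of_nonneg_right (ih (by omega) hfl) (pathMatrix_nonneg _ _)
      _ = ∑ l ∈ (Finset.univ.filter fun l : Fin n => s ≤ l.val).image f,
            (pathMatrix n ^ m) c l * pathMatrix n l j := by
          refine (Finset.sum_image (f := fun l => (pathMatrix n ^ m) c l * pathMatrix n l j)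
            fun a ha b hb hab => ?_).symm
          have ha : s ≤ (a : ℕ) := by simpa using ha
          have hb : s ≤ (b : ℕ) := by simpa using hb
          have hab : (a : ℕ) - s = b - s := congrArg Fin.val hab
          exact Fin.ext (by omega)
      _ ≤ _ := Finset.sum_le_univ_sum_of_nonneg fun l =>
          mul_nonneg (nonneg m c l) (pathMatrix_nonneg l j)

end Path

section Lollipop

theorem Matrix.trace_submatrix_equiv_pow {V W : Type*} [Fintype V] [DecidableEq V] [Fintype W]
    [DecidableEq W] (M : Matrix V V ℝ) (e : W ≃ V) (m : ℕ) :
    ((M.submatrix e e) ^ m).trace = (M ^ m).trace := by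
  have : (M.submatrix e e) ^ m = (M ^ m).submatrix e e :=
    (map_pow (Matrix.reindexAlgEquiv ℝ ℝ e.symm) M m).symm
  rw [this]
  exact e.sum_comp fun i => (M ^ m) i i

/-- The linear ordering of a lollipop: the cycle, ending at the attachment vertex, followed by
the tail. -/
def lollipopEquiv (p k : ℕ) : Fin p ⊕ Fin k ≃ Fin (p + k) :=
  (Equiv.sumCongr Fin.revPerm (Equiv.refl _)).trans finSumFinEquiv

theorem lollipop_adj_iff {p k : ℕ} (hp : 3 ≤ p) (a b : Fin p ⊕ Fin k) :
    (lollipop p k).Adj a b ↔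
      (((lollipopEquiv p k a : ℕ) + 1 = lollipopEquiv p k b ∨
        (lollipopEquiv p k b : ℕ) + 1 = lollipopEquiv p k a) ∨
      ((lollipopEquiv p k a : ℕ) = 0 ∧ (lollipopEquiv p k b : ℕ) = p - 1) ∨
      ((lollipopEquiv p k a : ℕ) = p - 1 ∧ (lollipopEquiv p k b : ℕ) = 0)) := by
  have hmod (i : Fin p) : ((i : ℕ) + 1) % p = if (i : ℕ) + 1 = p then 0 else (i : ℕ) + 1 := by
    split_ifs with h
    · rw [h, Nat.mod_self]
    · exact Nat.mod_eq_of_lt (by omega)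
  rcases a with i | i <;> rcases b with j | j <;>
    simp [lollipop, SimpleGraph.fromRel_adj, lollipopEquiv, Fin.ext_iff, Fin.val_rev, hmod,
      -Fin.val_eq_zero_iff] <;>
    try split_ifs
  all_goals omega

theorem adjMat_lollipop {p k : ℕ} (hp : 3 ≤ p) :
    adjMat (lollipop p k) =
      (pathMatrix (p + k) + edgeMatrix (⟨0, by omega⟩ : Fin (p + k)) ⟨p - 1, by omega⟩).submatrix
        (lollipopEquiv p k) (lollipopEquiv p k) := by
  classical
  ext a b
  have hadj : adjMat (lollipop p k) a b = if (lollipop p k).Adj a b then 1 else 0 := by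
    unfold adjMat
    rw [SimpleGraph.adjMatrix_apply]
  rw [hadj, lollipop_adj_iff hp]
  simp only [Matrix.submatrix_apply, Matrix.add_apply, pathMatrix, edgeMatrix, Matrix.of_apply,
    Matrix.single_apply, Fin.ext_iff]
  generalize (lollipopEquiv p k a : ℕ) = x
  generalize (lollipopEquiv p k b : ℕ) = y
  split_ifs <;> first | omega | norm_num

theorem trace_adjMat_lollipop_pow {p k n : ℕ} (hp : 3 ≤ p) (hn : p + k = n) (m : ℕ) :
    ((adjMat (lollipop p k)) ^ m).trace =
      ((pathMatrix n + edgeMatrix (⟨0, by omega⟩ : Fin n) ⟨p - 1, by omega⟩) ^ m).trace := by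
  subst hn
  rw [adjMat_lollipop hp, Matrix.trace_submatrix_equiv_pow]

theorem trace_adjMat_pow_eq_sum_roots {V : Type*} [Fintype V] [DecidableEq V]
    (G : SimpleGraph V) (m : ℕ) :
    ((adjMat G) ^ m).trace = ((graphCharpoly G).roots.map (· ^ m)).sum := by
  let := Classical.decRel G.Adj
  exact (G.isHermitian_adjMatrix ℝ).trace_pow_eq_sum_roots_charpoly m

end Lollipop

/-- Two lollipops `L(p,k)` and `L(p',k')` with the same number of vertices and `p < p'`
are not cospectral: indeed `L(p',k')` has strictly fewer closed walks of length `p`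
(the trace of the `p`-th power of the adjacency matrix) than `L(p,k)`. -/
theorem lollipops_not_cospectral (p k p' k' : ℕ) (hp : 3 ≤ p) (hpp' : p < p')
    (hn : p + k = p' + k') :
    graphCharpoly (lollipop p' k') ≠ graphCharpoly (lollipop p k) ∧
      ((adjMat (lollipop p' k')) ^ p).trace < ((adjMat (lollipop p k)) ^ p).trace := by
  have htrace :
      ((adjMat (lollipop p' k')) ^ p).trace < ((adjMat (lollipop p k)) ^ p).trace := by
    have hp' : 3 ≤ p' := by omega
    obtain ⟨N, rfl⟩ : ∃ N, p = N + 1 := ⟨p - 1, by omega⟩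
    rw [trace_adjMat_lollipop_pow hp hn, trace_adjMat_lollipop_pow hp' rfl]
    refine trace_edge_perturbation_pow_lt pathMatrix_isSymm pathMatrix_nonneg
      (fun m hm => pathMatrix_pow_apply_eq_zero ?_)
      (fun m hm => pathMatrix_pow_apply_shift_le (s := p' - (N + 1)) ?_ ?_ ?_)
      (pathMatrix_pow_apply_pos ?_) <;> dsimp only <;> omega
  refine ⟨fun h => htrace.ne ?_, htrace⟩
  rw [trace_adjMat_pow_eq_sum_roots, trace_adjMat_pow_eq_sum_roots, h]
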